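/- arXiv:2007.00152 — 2 statements merged into one kernel-verified Lean document; each statement's English description precedes it below -/
import Mathlib

section
/- Let m, n, N be positive integers such that N = 4n + m + ⌊6n/m⌋ + 1. Then every 2-coloring of the edges of the complete graph K_N with two colors yields a monochromatic copy of the fan F_n or a monochromatic copy of the complete graph K_m. -/
/-- The fan `F n`: vertex `0` is the center, adjacent to all other `2n` vertices,
and the vertices `2i+1`, `2i+2` (for `0 ≤ i < n`) form `n` pairwise disjoint edges. -/
def fanGraph (n : ℕ) : SimpleGraph (Fin (2 * n + 1)) :=
  SimpleGraph.fromRel (fun a b => a.val = 0 ∨ (a.val % 2 = 1 ∧ b.val = a.val + 1))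

/-- `H` is contained in `G` as a (not necessarily induced) subgraph. -/
def Contains {α β : Type*} (H : SimpleGraph α) (G : SimpleGraph β) : Prop :=
  ∃ f : α → β, Function.Injective f ∧ ∀ ⦃a b⦄, H.Adj a b → G.Adj (f a) (f b)

section

open Finset

/-- If `p` is a fixed-point-free involution of `T` and `#T ≥ 2n`, then `n` of its orbits can be
listed as the pairs `{f (2i), f (2i+1)}`. -/
lemma exists_pairs_of_involution {V : Type*} [Nonempty V] (p : V → V) (n : ℕ) :
    ∀ T : Finset V, (∀ x ∈ T, p x ∈ T) → (∀ x ∈ T, p (p x) = x) → (∀ x ∈ T, p x ≠ x) →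
      2 * n ≤ #T → ∃ f : ℕ → V, Set.InjOn f (Set.Iio (2 * n)) ∧ (∀ i < 2 * n, f i ∈ T) ∧
        ∀ i < n, f (2 * i + 1) = p (f (2 * i)) := by
  classical
  induction n with
  | zero => exact fun T _ _ _ _ => ⟨fun _ => Classical.arbitrary V, by simp, by simp, by simp⟩
  | succ n ih =>
    intro T hT hinv hne hcard
    obtain ⟨x, hx⟩ : T.Nonempty := card_pos.1 (by omega)
    have hcard' : #((T.erase x).erase (p x)) = #T - 1 - 1 := by
      rw [card_erase_of_mem (mem_erase.2 ⟨hne x hx, hT x hx⟩), card_erase_of_mem hx]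
    obtain ⟨f, hinj, hf, hp⟩ := ih ((T.erase x).erase (p x)) (by grind) (by grind) (by grind)
      (by omega)
    refine ⟨fun i => if i = 2 * n then x else if i = 2 * n + 1 then p x else f i, ?_, ?_, ?_⟩
    · intro i hi j hj hij
      have hfx : ∀ i < 2 * n, f i ≠ x ∧ f i ≠ p x := fun i hi => by
        have := hf i hi
        grind
      have hpx := hne x hx
      simp only [Set.mem_Iio] at hi hj
      by_cases hi' : i < 2 * n <;> by_cases hj' : j < 2 * n
      · have := hinj (Set.mem_Iio.2 hi') (Set.mem_Iio.2 hj')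
        grind
      · grind
      · grind
      · grind
    · intro i hi
      by_cases hi' : i < 2 * n
      · have := hf i hi'
        grind
      · grind
    · intro i hi
      by_cases hi' : i < n
      · have := hp i hi'
        grind
      · grind

/-- A matching with `n` edges of `G` inside `A`, listed as the pairs `f (2i), f (2i+1)`. -/
def HasMatching {V : Type*} (G : SimpleGraph V) (A : Finset V) (n : ℕ) : Prop :=
  ∃ f : ℕ → V, Set.InjOn f (Set.Iio (2 * n)) ∧ (∀ i < 2 * n, f i ∈ A) ∧
    ∀ i < n, G.Adj (f (2 * i)) (f (2 * i + 1))

/-- The join of `G.induce A` with a complete graph on `t` vertices. -/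
def joinComplete {V : Type*} (G : SimpleGraph V) (A : Finset V) (t : ℕ) :
    SimpleGraph (A ⊕ Fin t) where
  Adj x y := x ≠ y ∧ ∀ a b, x = Sum.inl a → y = Sum.inl b → G.Adj a b
  symm := ⟨fun _ _ h => ⟨h.1.symm, fun a b ha hb => (h.2 b a hb ha).symm⟩⟩
  loopless := ⟨fun _ h => h.1 rfl⟩

lemma hasMatching_of_isPerfectMatching {V : Type*} {G : SimpleGraph V} {A : Finset V} {n t : ℕ}
    {M : (joinComplete G A t).Subgraph} (hM : M.IsPerfectMatching) (hA : 2 * n + t ≤ #A)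
    (hn : 0 < n) : HasMatching G A n := by
  classical
  have hM' : ∀ x, ∃! y, M.Adj x y := SimpleGraph.Subgraph.isPerfectMatching_iff.1 hM
  choose p hp hpu using hM'
  simp only at hpu
  have hpp : ∀ x, p (p x) = x := fun x => (hpu _ _ (hp x).symm).symm
  have hpne : ∀ x, p x ≠ x := fun x => (hp x).adj_sub.ne'
  let T : Finset (A ⊕ Fin t) := univ.filter fun x => x.isLeft ∧ (p x).isLeft
  have hTcard : 2 * n ≤ #T := by
    have h1 : #(univ.filter fun x : A ⊕ Fin t => x.isLeft) = #A := by
      rw [← Fintype.card_subtype]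
      exact (Fintype.card_congr Equiv.subtypeSum).trans (by simp)
    have h2 : #(univ.filter fun x : A ⊕ Fin t => x.isRight) = t := by
      rw [← Fintype.card_subtype]
      exact (Fintype.card_congr Equiv.subtypeSum).trans (by simp)
    have h3 : (univ.filter fun x : A ⊕ Fin t => x.isLeft) ⊆
        T ∪ (univ.filter fun x : A ⊕ Fin t => x.isRight).image p := by
      intro x hx
      by_cases h : (p x).isLeft
      · exact mem_union_left _ (by simp_all [T])
      · exact mem_union_right _ (mem_image.2 ⟨p x, by simp_all, hpp x⟩)
    have h4 := card_le_card h3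
    have h5 := card_union_le T ((univ.filter fun x : A ⊕ Fin t => x.isRight).image p)
    have h6 := card_image_le (s := univ.filter fun x : A ⊕ Fin t => x.isRight) (f := p)
    omega
  obtain ⟨a, ha⟩ : A.Nonempty := card_pos.1 (by omega)
  have : Nonempty (A ⊕ Fin t) := ⟨Sum.inl ⟨a, ha⟩⟩
  obtain ⟨f, hinj, hf, hfp⟩ := exists_pairs_of_involution p n T
    (fun x hx => by
      simp only [T, mem_filter, mem_univ, true_and, hpp] at hx ⊢
      exact hx.symm) (fun x _ => hpp x) (fun x _ => hpne x) hTcard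
  have hf' : ∀ i < 2 * n, ∃ b : A, f i = Sum.inl b := fun i hi => by
    have := hf i hi
    simp only [T, mem_filter, mem_univ, true_and] at this
    exact Sum.isLeft_iff.1 this.1
  let g : A ⊕ Fin t → V := Sum.elim (fun b => b.1) (fun _ => a)
  refine ⟨fun i => g (f i), ?_, ?_, ?_⟩
  · intro i hi j hj hij
    obtain ⟨b, hb⟩ := hf' i hi
    obtain ⟨c, hc⟩ := hf' j hj
    apply hinj hi hj
    simp only [hb, hc, g, Sum.elim_inl] at hij ⊢
    rw [Subtype.ext hij]
  · intro i hi
    obtain ⟨b, hb⟩ := hf' i hi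
    simp [hb, g]
  · intro i hi
    obtain ⟨b, hb⟩ := hf' (2 * i) (by omega)
    obtain ⟨c, hc⟩ := hf' (2 * i + 1) (by omega)
    have hadj := (hp (f (2 * i))).adj_sub
    rw [← hfp i hi] at hadj
    simpa [hb, hc, g] using hadj.2 b c hb hc

/-- The hard direction of the Tutte–Berge formula, with the components of `G[A \ S]` recorded
by a labelling `c`. -/
lemma exists_labelling_of_not_hasMatching {V : Type*} [DecidableEq V] (G : SimpleGraph V)
    (A : Finset V) (n : ℕ) (hn : 0 < n) (hA : 2 * n ≤ #A) (hG : ¬ HasMatching G A n) :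
    ∃ S ⊆ A, ∃ c : V → ℕ, (∀ x ∈ A \ S, ∀ y ∈ A \ S, G.Adj x y → c x = c y) ∧
      #A + #S + 2 ≤ 2 * n + #((A \ S).image c) := by
  classical
  obtain ⟨t, ht⟩ : ∃ t, #A = 2 * n + t := ⟨#A - 2 * n, by omega⟩
  have hnoM : ¬ ∃ M : (joinComplete G A t).Subgraph, M.IsPerfectMatching :=
    fun ⟨M, hM⟩ => hG (hasMatching_of_isPerfectMatching hM ht.ge hn)
  rw [SimpleGraph.tutte] at hnoM
  push Not at hnoM
  obtain ⟨U, hU⟩ := hnoM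
  unfold SimpleGraph.IsTutteViolator at hU
  set K := ((⊤ : (joinComplete G A t).Subgraph).deleteVerts U).coe with hK
  have hpar := K.odd_ncard_oddComponents
  have hcardV : Nat.card ((⊤ : (joinComplete G A t).Subgraph).deleteVerts U).verts + U.ncard
      = 2 * (n + t) := by
    have h1 : ((⊤ : (joinComplete G A t).Subgraph).deleteVerts U).verts = Uᶜ := by
      ext
      simp
    rw [h1, Nat.card_coe_set_eq, add_comm, Set.ncard_add_ncard_compl]
    simp [ht]
    ring
  have hodd : U.ncard + 2 ≤ K.oddComponents.ncard := by
    rcases Nat.lt_or_ge (U.ncard + 1) K.oddComponents.ncard with h | h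
    · exact h
    · have h' : K.oddComponents.ncard = U.ncard + 1 := by omega
      rw [h', Nat.odd_iff, Nat.odd_iff] at hpar
      omega
  have hcomp : K.oddComponents.ncard ≤ Fintype.card K.ConnectedComponent := by
    rw [← Nat.card_eq_fintype_card, ← Set.ncard_univ]
    exact Set.ncard_le_ncard (Set.subset_univ _)
  have hapex : ∀ i, Sum.inr i ∈ U := by
    intro i
    by_contra hi
    have hi' : (Sum.inr i : A ⊕ Fin t) ∈
        ((⊤ : (joinComplete G A t).Subgraph).deleteVerts U).verts := by simpa using hi
    have : Fintype.card K.ConnectedComponent ≤ 1 := by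
      rw [Fintype.card_le_one_iff_subsingleton]
      refine SimpleGraph.Preconnected.subsingleton_connectedComponent ?_
      suffices h : ∀ x, K.Reachable x ⟨_, hi'⟩ from fun x y => (h x).trans (h y).symm
      intro x
      by_cases hx : x = ⟨_, hi'⟩
      · rw [hx]
      · refine SimpleGraph.Adj.reachable ?_
        have hx' : x.1 ≠ Sum.inr i := fun h => hx (Subtype.ext h)
        have hxU : x.1 ∉ U := by simpa using x.2
        simp only [hK, SimpleGraph.Subgraph.coe_adj, SimpleGraph.Subgraph.deleteVerts_adj]
        exact ⟨trivial, hxU, trivial, hi, hx', by simp⟩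
    omega
  have hmem : ∀ a : A, Sum.inl a ∉ U →
      Sum.inl a ∈ ((⊤ : (joinComplete G A t).Subgraph).deleteVerts U).verts := by simp
  let e := Fintype.equivFin K.ConnectedComponent
  let c : V → ℕ := fun v => if h : ∃ hv : v ∈ A, Sum.inl ⟨v, hv⟩ ∉ U then
    e (K.connectedComponentMk ⟨_, hmem _ h.2⟩) else 0
  let S : Finset V := A.filter fun v => ∃ hv : v ∈ A, Sum.inl ⟨v, hv⟩ ∈ U
  have hmemS : ∀ v, v ∈ A \ S ↔ ∃ hv : v ∈ A, Sum.inl ⟨v, hv⟩ ∉ U := by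
    intro v
    simp only [S, mem_sdiff, mem_filter]
    grind
  refine ⟨S, filter_subset _ _, c, ?_, ?_⟩
  · intro x hx y hy hxy
    rw [hmemS] at hx hy
    simp only [c, dif_pos hx, dif_pos hy]
    congr 2
    refine SimpleGraph.ConnectedComponent.sound (SimpleGraph.Adj.reachable ?_)
    simp only [hK, SimpleGraph.Subgraph.coe_adj, SimpleGraph.Subgraph.deleteVerts_adj]
    refine ⟨trivial, hx.2, trivial, hy.2, ?_, ?_⟩
    · simpa using hxy.ne
    · rintro a b ha hb
      cases ha
      cases hb
      exact hxy
  · have hScard : t + #S ≤ U.ncard := by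
      have hinj : Function.Injective (fun x : Fin t ⊕ S => (show U from
          Sum.elim (fun i => ⟨Sum.inr i, hapex i⟩)
            (fun s => ⟨Sum.inl ⟨s.1, (mem_filter.1 s.2).1⟩, (mem_filter.1 s.2).2.2⟩) x)) := by
        rintro (i | s) (j | s') h <;> have h := congrArg Subtype.val h
        · exact congrArg Sum.inl (Sum.inr.inj h)
        · cases h
        · cases h
        · have hval := congrArg Subtype.val (Sum.inl.inj h : (⟨s.1, _⟩ : A) = ⟨s'.1, _⟩)
          exact congrArg Sum.inr (Subtype.ext hval)
      have := Nat.card_le_card_of_injective _ hinj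
      rw [Nat.card_coe_set_eq] at this
      simpa using this
    have hcard : Fintype.card K.ConnectedComponent ≤ #((A \ S).image c) := by
      have hsub : (univ : Finset K.ConnectedComponent).image (fun k => (e k : ℕ))
          ⊆ (A \ S).image c := by
        intro k hk
        obtain ⟨k, -, rfl⟩ := mem_image.1 hk
        induction k using SimpleGraph.ConnectedComponent.ind with
        | h v =>
          obtain ⟨x, hx⟩ := v
          have hxU : x ∉ U := by simpa using hx
          rcases x with a | i
          · have ha : ∃ hv : a.1 ∈ A, Sum.inl ⟨a.1, hv⟩ ∉ U := ⟨a.2, hxU⟩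
            refine mem_image.2 ⟨a.1, (hmemS _).2 ha, ?_⟩
            simp only [c, dif_pos ha]
          · exact absurd (hapex i) hxU
      have := card_le_card hsub
      rwa [card_image_of_injective _ (fun a b h => e.injective (Fin.ext h)), card_univ] at this
    omega

lemma contains_fanGraph_of_hasMatching {V : Type*} {G : SimpleGraph V} {A : Finset V} {n : ℕ}
    (v : V) (hv : ∀ x ∈ A, G.Adj v x) (h : HasMatching G A n) : Contains (fanGraph n) G := by
  obtain ⟨f, hinj, hf, hadj⟩ := h
  have hvf : ∀ i < 2 * n, G.Adj v (f i) := fun i hi => hv _ (hf i hi)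
  let g : Fin (2 * n + 1) → V := fun a => if a.val = 0 then v else f (a.val - 1)
  have hg_zero : ∀ a, a.val = 0 → g a = v := fun a ha => if_pos ha
  have hg_pos : ∀ a, a.val ≠ 0 → g a = f (a.val - 1) := fun a ha => if_neg ha
  have hg : ∀ a b : Fin (2 * n + 1), a ≠ b →
      (a.val = 0 ∨ (a.val % 2 = 1 ∧ b.val = a.val + 1)) → G.Adj (g a) (g b) := by
    intro a b hab h
    have hab' : a.val ≠ b.val := fun h => hab (Fin.ext h)
    by_cases ha : a.val = 0
    · have hb : b.val ≠ 0 := by omega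
      rw [hg_zero a ha, hg_pos b hb]
      exact hvf (b.val - 1) (by omega)
    · have hb : b.val ≠ 0 := by omega
      have := hadj ((a.val - 1) / 2) (by omega)
      rw [hg_pos a ha, hg_pos b hb]
      convert this using 2 <;> omega
  refine ⟨g, ?_, ?_⟩
  · intro a b hab
    by_cases ha : a.val = 0 <;> by_cases hb : b.val = 0
    · exact Fin.ext (ha.trans hb.symm)
    · exact absurd (by rw [← hg_zero a ha, ← hg_pos b hb, hab]) (hvf (b.val - 1) (by omega)).ne
    · exact absurd (by rw [← hg_zero b hb, ← hg_pos a ha, hab]) (hvf (a.val - 1) (by omega)).ne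
    · have := hinj (Set.mem_Iio.2 (by omega)) (Set.mem_Iio.2 (by omega))
        (show f (a.val - 1) = f (b.val - 1) by rw [← hg_pos a ha, ← hg_pos b hb, hab])
      exact Fin.ext (by omega)
  · intro a b hab
    rw [fanGraph, SimpleGraph.fromRel_adj] at hab
    obtain ⟨hne, h | h⟩ := hab
    · exact hg a b hne h
    · exact (hg b a hne.symm h).symm

lemma contains_top_compl_of_card_image {V : Type*} {G : SimpleGraph V} {B : Finset V}
    {c : V → ℕ} {m : ℕ} (hc : ∀ x ∈ B, ∀ y ∈ B, G.Adj x y → c x = c y)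
    (hm : m ≤ #(B.image c)) : Contains (⊤ : SimpleGraph (Fin m)) Gᶜ := by
  have hex : ∀ k : B.image c, ∃ x ∈ B, c x = k := fun k => mem_image.1 k.2
  choose r hrB hr using hex
  have hrinj : Function.Injective r := fun k l h => Subtype.ext (by rw [← hr k, ← hr l, h])
  obtain ⟨j⟩ : Nonempty (Fin m ↪ B.image c) :=
    Function.Embedding.nonempty_of_card_le (by simpa using hm)
  refine ⟨fun i => r (j i), hrinj.comp j.injective, fun a b hab => ?_⟩
  have hne : j a ≠ j b := fun h => hab.ne (j.injective h)
  refine (SimpleGraph.compl_adj _ _ _).2 ⟨fun h => hne (hrinj h), fun h => hne ?_⟩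
  exact Subtype.ext (by rw [← hr (j a), ← hr (j b), hc _ (hrB _) _ (hrB _) h])

/-- The fan-or-clique alternative, given a vertex of large degree in `G`. -/
lemma fan_or_clique_of_neighbors {V : Type*} (G : SimpleGraph V) (m n : ℕ) (hm : 0 < m)
    (hn : 0 < n) (v : V) (A : Finset V) (hv : ∀ x ∈ A, G.Adj v x)
    (hA : 4 * n + m + 6 * n / m ≤ 2 * #A) :
    (Contains (fanGraph n) G ∨ Contains (⊤ : SimpleGraph (Fin m)) G) ∨
    (Contains (fanGraph n) Gᶜ ∨ Contains (⊤ : SimpleGraph (Fin m)) Gᶜ) := by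
  classical
  by_contra hcon
  push Not at hcon
  obtain ⟨⟨hF, hK⟩, hF', hK'⟩ := hcon
  have hdiv : 6 * n < m * (6 * n / m + 1) := Nat.lt_mul_div_succ _ hm
  generalize 6 * n / m = f at hA hdiv
  obtain ⟨S, hSA, c, hc, hcard⟩ := exists_labelling_of_not_hasMatching G A n hn (by omega)
    (fun h => hF (contains_fanGraph_of_hasMatching v hv h))
  have hq : #((A \ S).image c) < m :=
    lt_of_not_ge fun h => hK' (contains_top_compl_of_card_image hc h)
  have hAS := card_sdiff_add_card_eq_card hSA
  obtain ⟨k, hk, hmin⟩ := exists_min_image ((A \ S).image c)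
    (fun k => #((A \ S).filter fun x => c x = k)) (card_pos.1 (by omega))
  obtain ⟨u, hu, huk⟩ := mem_image.1 hk
  set P := (A \ S).filter fun x => c x = k
  have hqz : #((A \ S).image c) * #P ≤ #(A \ S) := by
    rw [card_eq_sum_card_image c (A \ S), ← smul_eq_mul]
    exact card_nsmul_le_sum _ _ _ hmin
  set W := (A \ S) \ P
  have hW := card_sdiff_add_card_eq_card (filter_subset (fun x => c x = k) (A \ S))
  change #W + #P = _ at hW
  have hWmem : ∀ x, x ∈ W ↔ x ∈ A \ S ∧ c x ≠ k := by
    intro x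
    simp only [W, P, mem_sdiff, mem_filter]
    tauto
  have hcross : ∀ x ∈ A \ S, ∀ y ∈ A \ S, c x ≠ c y → Gᶜ.Adj x y := fun x hx y hy hxy =>
    (SimpleGraph.compl_adj _ _ _).2 ⟨fun h => hxy (h ▸ rfl), fun h => hxy (hc x hx y hy h)⟩
  have hPsmall : #P < f + 3 := by
    by_contra! hz
    nlinarith
  obtain ⟨S', hSW, c', hc', hcard'⟩ := exists_labelling_of_not_hasMatching Gᶜ W n hn (by omega)
    (fun h => hF' (contains_fanGraph_of_hasMatching u (fun x hx =>
      hcross u hu x ((hWmem x).1 hx).1 (huk ▸ ((hWmem x).1 hx).2.symm)) h))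
  have hq' : #((W \ S').image c') < m := lt_of_not_ge fun h =>
    hK (by simpa using contains_top_compl_of_card_image hc' h)
  have hone : #((W \ S').image c) ≤ 1 := by
    rw [card_le_one_iff]
    by_contra! hne
    obtain ⟨i, j, hi, hj, hij⟩ := hne
    obtain ⟨x, hx, rfl⟩ := mem_image.1 hi
    obtain ⟨y, hy, rfl⟩ := mem_image.1 hj
    have hadj : ∀ a ∈ W \ S', ∀ b ∈ W \ S', c a ≠ c b → c' a = c' b := fun a ha b hb hab =>
      hc' a ha b hb (hcross a ((hWmem a).1 (mem_sdiff.1 ha).1).1 b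
        ((hWmem b).1 (mem_sdiff.1 hb).1).1 hab)
    have hle : #((W \ S').image c') ≤ 1 := by
      have hsub : (W \ S').image c' ⊆ {c' x} := by
        intro l hl
        obtain ⟨w, hw, rfl⟩ := mem_image.1 hl
        rw [mem_singleton]
        by_cases hwx : c w = c x
        · rw [hadj w hw y hy (hwx ▸ hij), hadj x hx y hy hij]
        · exact hadj w hw x hx hwx
      exact card_le_card hsub
    omega
  have hparts : #((A \ S).image c) ≤ #S' + 2 := by
    have hsub : (A \ S).image c ⊆ insert k (S'.image c ∪ (W \ S').image c) := by
      intro l hl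
      obtain ⟨w, hw, rfl⟩ := mem_image.1 hl
      have := hWmem w
      by_cases hwk : c w = k
      · simp [hwk]
      · refine mem_insert_of_mem ?_
        rw [← image_union]
        exact mem_image_of_mem _ (by simp only [mem_union, mem_sdiff]; tauto)
    have h1 := card_le_card hsub
    have h2 := card_insert_le k (S'.image c ∪ (W \ S').image c)
    have h3 := card_union_le (S'.image c) ((W \ S').image c)
    have h4 := card_image_le (s := S') (f := c)
    omega
  omega

end

/-- If `N = 4n + m + ⌊6n/m⌋ + 1`, then every `2`-coloring of the edges of `K_N`
(encoded by one color class `G`, the other being its complement) yields a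
monochromatic copy of the fan `F_n` or a monochromatic copy of `K_m`. -/
theorem fan_or_clique (m n N : ℕ) (hm : 0 < m) (hn : 0 < n)
    (hN : N = 4 * n + m + 6 * n / m + 1)
    (G : SimpleGraph (Fin N)) :
    (Contains (fanGraph n) G ∨ Contains (⊤ : SimpleGraph (Fin m)) G) ∨
    (Contains (fanGraph n) Gᶜ ∨ Contains (⊤ : SimpleGraph (Fin m)) Gᶜ) := by
  have hdivpos : 0 ≤ 6 * n / m := Nat.zero_le _
  obtain ⟨v⟩ : Nonempty (Fin N) := ⟨⟨0, by omega⟩⟩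
  classical
  have hdeg := G.degree_compl v
  have hlt := G.degree_lt_card_verts v
  rw [Fintype.card_fin] at hdeg hlt
  rcases Nat.le_total (Gᶜ.degree v) (G.degree v) with h | h
  · refine fan_or_clique_of_neighbors G m n hm hn v (G.neighborFinset v) (by simp) ?_
    rw [SimpleGraph.card_neighborFinset_eq_degree]
    omega
  · have := fan_or_clique_of_neighbors Gᶜ m n hm hn v (Gᶜ.neighborFinset v) (by simp) ?_
    · rw [compl_compl] at this
      exact this.symm
    · rw [SimpleGraph.card_neighborFinset_eq_degree]
      omega
end

section
/- Let m, n be positive integers with m ≤ n ≤ 3m/2 - 3. Then the off-diagonal Ramsey number of fans satisfies r(F_n, F_m) ≥ 3m/2 + 3n - 5. Equivalently: letting t be the largest even integer less than m/2 + n, there exists a graph G on 3t vertices such that G contains no copy of F_n and its complement contains no copy of F_m, so r(F_n, F_m) ≥ 3t + 1 ≥ 3m/2 + 3n - 5. -/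
theorem Contains.trans {α β γ : Type*} {H : SimpleGraph α} {G : SimpleGraph β}
    {K : SimpleGraph γ} (h₁ : Contains H G) (h₂ : Contains G K) : Contains H K := by
  obtain ⟨f, hf, hf'⟩ := h₁
  obtain ⟨g, hg, hg'⟩ := h₂
  exact ⟨g ∘ f, hg.comp hf, fun _ _ h => hg' (hf' h)⟩

/-- Graphs avoiding two fans restrict along injections. -/
theorem exists_fan_free_of_injective {α β : Type*} {n m : ℕ} (e : α → β)
    (he : Function.Injective e) (G : SimpleGraph β)
    (h₁ : ¬ Contains (fanGraph n) G) (h₂ : ¬ Contains (fanGraph m) Gᶜ) :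
    ∃ G' : SimpleGraph α, ¬ Contains (fanGraph n) G' ∧ ¬ Contains (fanGraph m) G'ᶜ := by
  refine ⟨G.comap e, fun h => h₁ (h.trans ⟨e, he, fun _ _ h => h⟩),
    fun h => h₂ (h.trans ⟨e, he, fun a b h => ?_⟩)⟩
  rw [SimpleGraph.compl_adj] at h ⊢
  exact ⟨he.ne h.1, h.2⟩

theorem fanGraph_adj_center {n : ℕ} (j : Fin (2 * n + 1)) (hj : j ≠ 0) :
    (fanGraph n).Adj 0 j := by
  rw [fanGraph, SimpleGraph.fromRel_adj]
  exact ⟨hj.symm, Or.inl (Or.inl rfl)⟩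

theorem fanGraph_adj_blade {n : ℕ} (i : Fin n) :
    (fanGraph n).Adj ⟨2 * i + 1, by omega⟩ ⟨2 * i + 2, by omega⟩ := by
  rw [fanGraph, SimpleGraph.fromRel_adj]
  refine ⟨?_, Or.inl (Or.inr ⟨?_, ?_⟩)⟩
  · simp
  · simp only []
    omega
  · simp only []

/-- A graph whose closed neighbourhoods all have at most `2n` vertices contains no `F_n`. -/
theorem not_contains_fanGraph_of_card_le {V : Type*} {n : ℕ} {G : SimpleGraph V}
    (h : ∀ v, ∃ C : Finset V, C.card ≤ 2 * n ∧ v ∈ C ∧ ∀ w, G.Adj v w → w ∈ C) :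
    ¬ Contains (fanGraph n) G := by
  rintro ⟨f, hf, hadj⟩
  obtain ⟨C, hC, hv, hw⟩ := h (f 0)
  have hle : (Finset.univ : Finset (Fin (2 * n + 1))).card ≤ C.card := by
    refine Finset.card_le_card_of_injOn f (fun j _ => ?_) hf.injOn
    by_cases hj : j = 0
    · exact hj ▸ hv
    · exact hw _ (hadj (fanGraph_adj_center j hj))
  rw [Finset.card_univ, Fintype.card_fin] at hle
  omega

/-- A graph in which the edges inside each neighbourhood are covered by fewer than `m` vertices
contains no `F_m`. -/
theorem not_contains_fanGraph_of_cover {V : Type*} {m : ℕ} {G : SimpleGraph V}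
    (h : ∀ v, ∃ C : Finset V, C.card < m ∧
      ∀ a b, G.Adj v a → G.Adj v b → G.Adj a b → a ∈ C ∨ b ∈ C) :
    ¬ Contains (fanGraph m) G := by
  rintro ⟨f, hf, hadj⟩
  obtain ⟨C, hC, hcov⟩ := h (f 0)
  have key : ∀ i : Fin m, ∃ j : Fin (2 * m + 1),
      (j.val = 2 * i + 1 ∨ j.val = 2 * i + 2) ∧ f j ∈ C := by
    intro i
    rcases hcov _ _
      (hadj (fanGraph_adj_center ⟨2 * i + 1, by omega⟩ (by simp [Fin.ext_iff])))
      (hadj (fanGraph_adj_center ⟨2 * i + 2, by omega⟩ (by simp [Fin.ext_iff])))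
      (hadj (fanGraph_adj_blade i)) with h | h
    · exact ⟨_, Or.inl rfl, h⟩
    · exact ⟨_, Or.inr rfl, h⟩
  choose g hg hgC using key
  have hle : (Finset.univ : Finset (Fin m)).card ≤ C.card := by
    refine Finset.card_le_card_of_injOn (fun i => f (g i)) (fun i _ => hgC i) ?_
    intro i _ j _ hij
    have h1 := congrArg Fin.val (hf hij)
    have h2 := hg i
    have h3 := hg j
    ext
    omega
  rw [Finset.card_univ, Fintype.card_fin] at hle
  omega

/-- The part joined to the half `b` of part `i`. -/
def partnerPart (i : ZMod 3) (b : Bool) : ZMod 3 := if b then i + 1 else i - 1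

theorem partnerPart_partnerPart (i : ZMod 3) (b : Bool) :
    partnerPart (partnerPart i b) (!b) = i := by
  cases b <;> simp [partnerPart]

theorem eq_partnerPart_or_eq_partnerPart {i p q : ZMod 3} (b : Bool)
    (hp : i ≠ p) (hq : i ≠ q) (hpq : p ≠ q) : p = partnerPart i b ∨ q = partnerPart i b := by
  revert i p q b
  unfold partnerPart
  decide

/-- Three disjoint cliques, each split into two halves of size `k`; the halves are paired up
between different cliques, and paired halves are joined by an `s`-regular bipartite graph. -/
def pairedCliques (k s : ℕ) : SimpleGraph (ZMod 3 × Bool × ZMod k) where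
  Adj v w := v ≠ w ∧ (v.1 = w.1 ∨
    (w.1 = partnerPart v.1 v.2.1 ∧ w.2.1 = !v.2.1 ∧ (v.2.2 + w.2.2).val < s))
  symm := ⟨by
    rintro ⟨i, b, x⟩ ⟨j, c, y⟩ ⟨hne, h⟩
    refine ⟨hne.symm, h.imp Eq.symm ?_⟩
    rintro ⟨h1, h2, h3⟩
    simp only at h1 h2 h3 ⊢
    subst h1 h2
    exact ⟨(partnerPart_partnerPart i b).symm, (Bool.not_not b).symm, by rwa [add_comm]⟩⟩
  loopless := ⟨fun _ h => h.1 rfl⟩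

theorem card_filter_add_val_lt_le {k : ℕ} [NeZero k] (s : ℕ) (x : ZMod k) :
    (Finset.univ.filter fun y : ZMod k => (x + y).val < s).card ≤ s := by
  conv_rhs => rw [← Finset.card_range s]
  refine Finset.card_le_card_of_injOn (fun y => (x + y).val) (fun y hy => ?_) ?_
  · simpa using hy
  · intro y _ z _ h
    exact add_left_cancel (ZMod.val_injective k h)

theorem card_filter_le_add_val_le {k : ℕ} [NeZero k] (s : ℕ) (x : ZMod k) :
    (Finset.univ.filter fun y : ZMod k => s ≤ (x + y).val).card ≤ k - s := by
  rw [← Nat.card_Ico]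
  refine Finset.card_le_card_of_injOn (fun y => (x + y).val) (fun y hy => ?_) ?_
  · simpa [ZMod.val_lt] using hy
  · intro y _ z _ h
    exact add_left_cancel (ZMod.val_injective k h)

theorem pairedCliques_not_contains_fanGraph {k s n : ℕ} [NeZero k] (h : 2 * k + s ≤ 2 * n) :
    ¬ Contains (fanGraph n) (pairedCliques k s) := by
  classical
  refine not_contains_fanGraph_of_card_le ?_
  rintro ⟨i, b, x⟩
  refine ⟨{i} ×ˢ Finset.univ ∪ {partnerPart i b} ×ˢ {!b} ×ˢ
    Finset.univ.filter fun y : ZMod k => (x + y).val < s, ?_, by simp, ?_⟩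
  · refine (Finset.card_union_le _ _).trans ?_
    have := card_filter_add_val_lt_le s x
    simp only [Finset.card_product, Finset.card_singleton, Finset.card_univ, Fintype.card_prod,
      Fintype.card_bool, ZMod.card]
    omega
  · rintro ⟨j, c, y⟩ ⟨-, h | ⟨h1, h2, h3⟩⟩
    · simp only at h
      simp [h]
    · simp only at h1 h2 h3
      simp [h1, h2, h3]

theorem pairedCliques_compl_not_contains_fanGraph {k s m : ℕ} [NeZero k]
    (h : k + (k - s) < m) : ¬ Contains (fanGraph m) (pairedCliques k s)ᶜ := by
  classical
  refine not_contains_fanGraph_of_cover ?_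
  rintro ⟨i, b, x⟩
  refine ⟨{partnerPart i b} ×ˢ ({b} ×ˢ Finset.univ ∪ {!b} ×ˢ
    Finset.univ.filter fun y : ZMod k => s ≤ (x + y).val), ?_, ?_⟩
  · rw [Finset.card_product, Finset.card_singleton, one_mul]
    refine (Finset.card_union_le _ _).trans_lt ?_
    have := card_filter_le_add_val_le s x
    simp only [Finset.card_product, Finset.card_singleton, Finset.card_univ, ZMod.card]
    omega
  · have hpart : ∀ v w, (pairedCliques k s)ᶜ.Adj v w → v.1 ≠ w.1 := fun v w hvw he =>
      ((SimpleGraph.compl_adj _ _ _).1 hvw).2 ⟨hvw.ne, Or.inl he⟩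
    have hmem : ∀ w, (pairedCliques k s)ᶜ.Adj (i, b, x) w → w.1 = partnerPart i b →
        w ∈ ({partnerPart i b} ×ˢ ({b} ×ˢ Finset.univ ∪ {!b} ×ˢ
          Finset.univ.filter fun y : ZMod k => s ≤ (x + y).val) :
            Finset (ZMod 3 × Bool × ZMod k)) := by
      rintro ⟨j, c, y⟩ hw hj
      have hc : c = !b → s ≤ (x + y).val := fun hc => not_lt.1 fun hlt =>
        ((SimpleGraph.compl_adj _ _ _).1 hw).2 ⟨hw.ne, Or.inr ⟨hj, hc, hlt⟩⟩
      simp only at hj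
      subst hj
      cases b <;> cases c <;> simp_all
    intro v w hv hw hvw
    exact (eq_partnerPart_or_eq_partnerPart b (hpart _ _ hv) (hpart _ _ hw) (hpart _ _ hvw)).imp
      (hmem v hv) (hmem w hw)

/-- For `m ≤ n ≤ 3m/2 - 3`, `r(F_n, F_m) ≥ 3m/2 + 3n - 5`: letting `t` be the
largest even integer with `t < m/2 + n`, there is a graph `G` on `3t` vertices
containing no copy of `F_n` whose complement contains no copy of `F_m`;
moreover `3t + 1 ≥ 3m/2 + 3n - 5`, and consequently for every
`N < 3m/2 + 3n - 5` there is a red-blue coloring of the edges of `K_N` (the red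
graph being `G`, the blue one its complement) with no red `F_n` and no blue
`F_m`, i.e. `r(F_n, F_m) ≥ 3m/2 + 3n - 5`. -/
theorem fan_fan_ramsey_lower (m n : ℕ) (hm : 0 < m) (hmn : m ≤ n)
    (hn : 2 * n + 6 ≤ 3 * m)
    (t : ℕ) (ht_even : Even t) (ht_lt : 2 * t < m + 2 * n)
    (ht_max : ∀ s : ℕ, Even s → 2 * s < m + 2 * n → s ≤ t) :
    (∃ G : SimpleGraph (Fin (3 * t)),
        ¬ Contains (fanGraph n) G ∧ ¬ Contains (fanGraph m) Gᶜ) ∧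
    3 * m + 6 * n ≤ 2 * (3 * t + 1) + 10 ∧
    (∀ N : ℕ, 2 * N + 10 < 3 * m + 6 * n →
      ∃ G : SimpleGraph (Fin N),
        ¬ Contains (fanGraph n) G ∧ ¬ Contains (fanGraph m) Gᶜ) := by
  have hmax := ht_max (t + 2) (ht_even.add even_two)
  obtain ⟨k, rfl⟩ := ht_even
  have : NeZero k := ⟨by omega⟩
  have hcard : Fintype.card (ZMod 3 × Bool × ZMod k) = 3 * (k + k) := by
    simp only [Fintype.card_prod, ZMod.card, Fintype.card_bool]
    ring
  have h₁ : ¬ Contains (fanGraph n) (pairedCliques k (k + k + 1 - m)) :=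
    pairedCliques_not_contains_fanGraph (by omega)
  have h₂ : ¬ Contains (fanGraph m) (pairedCliques k (k + k + 1 - m))ᶜ :=
    pairedCliques_compl_not_contains_fanGraph (by omega)
  have hexists : ∀ N ≤ 3 * (k + k), ∃ G : SimpleGraph (Fin N),
      ¬ Contains (fanGraph n) G ∧ ¬ Contains (fanGraph m) Gᶜ := fun N hN =>
    exists_fan_free_of_injective
      ((Fintype.equivFinOfCardEq hcard).symm ∘ Fin.castLE hN)
      ((Equiv.injective _).comp (Fin.castLE_injective hN)) _ h₁ h₂
  exact ⟨hexists _ le_rfl, by omega, fun N hN => hexists N (by omega)⟩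
end
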